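/- Let F_1 and F_2 be k-uniform hypergraphs with m_k(F_1) ≥ m_k(F_2) > 0 such that F_1 is strictly balanced with respect to m_k(·, F_2). Let 𝓕 be a family of subgraphs of the complete k-uniform hypergraph K_n^{(k)} such that each member of 𝓕 is the union of two distinct copies of F_1 intersecting in at least one edge. For a constant C > 0, let p = C·n^{-1/m_k(F_1,F_2)} and let X be the number of members of 𝓕 contained in H^k(n,p). Then there exist constants δ > 0 and C' > 0 such that E[X] ≤ C'·n^{k - 1/m_k(F_2) - δ/2}. -/

import Mathlib

open scoped Classical

namespace ARR

/-- The vertex support of a hypergraph given by its edge set. -/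
def vset (G : Finset (Finset ℕ)) : Finset ℕ := G.sup id

/-- Number of vertices of a hypergraph. -/
def vcount (G : Finset (Finset ℕ)) : ℕ := (vset G).card

/-- `G` is a `k`-uniform hypergraph. -/
def IsUniform (k : ℕ) (G : Finset (Finset ℕ)) : Prop := ∀ e ∈ G, e.card = k

/-- The `k`-density `d_k`. -/
noncomputable def dk (k : ℕ) (G : Finset (Finset ℕ)) : ℝ :=
  if G.card = 0 then 0
  else if G.card = 1 ∧ vcount G = k then 1 / (k : ℝ)
  else ((G.card : ℝ) - 1) / ((vcount G : ℝ) - (k : ℝ))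

/-- The `k`-density `m_k`: the maximum of `d_k` over subgraphs. -/
noncomputable def mk (k : ℕ) (G : Finset (Finset ℕ)) : ℝ :=
  sSup {x : ℝ | ∃ H ⊆ G, x = dk k H}

/-- The usual density `m(G)`. -/
noncomputable def mDens (G : Finset (Finset ℕ)) : ℝ :=
  sSup {x : ℝ | ∃ H ⊆ G, 1 ≤ vcount H ∧ x = (H.card : ℝ) / (vcount H : ℝ)}

/-- `G` is strictly `k`-balanced: every proper subgraph has strictly smaller `k`-density. -/
def StrictlyKBalanced (k : ℕ) (G : Finset (Finset ℕ)) : Prop :=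
  ∀ H ⊆ G, H ≠ G → dk k H < dk k G

/-- The asymmetric `k`-density `m_k(F₁,F₂)`. -/
noncomputable def mkA (k : ℕ) (F1 F2 : Finset (Finset ℕ)) : ℝ :=
  sSup {x : ℝ | ∃ H ⊆ F1, H.Nonempty ∧
    x = (H.card : ℝ) / ((vcount H : ℝ) - (k : ℝ) + 1 / mk k F2)}

/-- `F₁` is strictly balanced with respect to `m_k(·, F₂)`. -/
def StrictlyBalancedWrt (k : ℕ) (F1 F2 : Finset (Finset ℕ)) : Prop :=
  ∀ H ⊆ F1, H.Nonempty → H ≠ F1 →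
    (H.card : ℝ) / ((vcount H : ℝ) - (k : ℝ) + 1 / mk k F2) < mkA k F1 F2

/-- `F'` is a copy of `F` (an isomorphic image of `F`). -/
def IsCopy (F F' : Finset (Finset ℕ)) : Prop :=
  ∃ f : ℕ → ℕ, Set.InjOn f ↑(vset F) ∧ F' = F.image (Finset.image f)

/-- `G` contains a copy of `F`. -/
def ContainsCopy (G F : Finset (Finset ℕ)) : Prop := ∃ F' ⊆ G, IsCopy F F'

/-- Asymmetric Ramsey arrow `G → (F₁, …, F_r)`. -/
def Arrow {r : ℕ} (G : Finset (Finset ℕ)) (F : Fin r → Finset (Finset ℕ)) : Prop :=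
  ∀ χ : Finset ℕ → Fin r, ∃ i : Fin r, ∃ F' ⊆ G, IsCopy (F i) F' ∧ ∀ e ∈ F', χ e = i

/-- Symmetric Ramsey arrow `G → (F)_r`. -/
def ArrowSym (G F : Finset (Finset ℕ)) (r : ℕ) : Prop :=
  ∀ χ : Finset ℕ → Fin r, ∃ i : Fin r, ∃ F' ⊆ G, IsCopy F F' ∧ ∀ e ∈ F', χ e = i

/-- Two-colour asymmetric arrow `G → (F₁, F₂)`. -/
def Arrow2 (G F1 F2 : Finset (Finset ℕ)) : Prop :=
  ∀ χ : Finset ℕ → Fin 2,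
    (∃ F' ⊆ G, IsCopy F1 F' ∧ ∀ e ∈ F', χ e = 0) ∨
    (∃ F' ⊆ G, IsCopy F2 F' ∧ ∀ e ∈ F', χ e = 1)

/-- The edge set of the complete `k`-uniform hypergraph on `{0, …, n-1}`. -/
def allEdges (k n : ℕ) : Finset (Finset ℕ) := (Finset.range n).powersetCard k

/-- Probability that the binomial random hypergraph `H^k(n,p)` satisfies property `P`. -/
noncomputable def prob (k n : ℕ) (p : ℝ) (P : Finset (Finset ℕ) → Prop) : ℝ :=
  ∑ G ∈ (allEdges k n).powerset,
    if P G then p ^ G.card * (1 - p) ^ ((allEdges k n).card - G.card) else 0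

/-- Expected number of members of a family `𝓕` which appear as subgraphs of `H^k(n,p)`. -/
noncomputable def expectCount (k n : ℕ) (p : ℝ) (𝓕 : Finset (Finset (Finset ℕ))) : ℝ :=
  ∑ G ∈ (allEdges k n).powerset,
    (p ^ G.card * (1 - p) ^ ((allEdges k n).card - G.card)) *
      ((𝓕.filter (fun F => F ⊆ G)).card : ℝ)

/-- `K₃^{+k}`: the triangle on `{0,1,2}` with the `k-2` vertices `{3,…,k}` added to each edge. -/
def K3plus (k : ℕ) : Finset (Finset ℕ) :=
  {({0, 1} : Finset ℕ) ∪ (Finset.range (k + 1)).filter (fun x => 3 ≤ x),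
   ({0, 2} : Finset ℕ) ∪ (Finset.range (k + 1)).filter (fun x => 3 ≤ x),
   ({1, 2} : Finset ℕ) ∪ (Finset.range (k + 1)).filter (fun x => 3 ≤ x)}

/-- The `i`-th edge `{i, i+1, …, i+k-1}` (mod `t`) of the tight cycle on `t` vertices. -/
def cycEdge (k t i : ℕ) : Finset ℕ := (Finset.range k).image (fun j => (i + j) % t)

/-- The tight cycle `C_t` (k-uniform) on vertex set `{0, …, t-1}`. -/
def tightCycle (k t : ℕ) : Finset (Finset ℕ) := (Finset.range t).image (cycEdge k t)

/-- The tight path `T^k_ℓ` on vertex set `{0, …, ℓ-1}`. -/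
def tightPath (k l : ℕ) : Finset (Finset ℕ) :=
  (Finset.range (l - k + 1)).image (fun i => (Finset.range k).image (fun j => i + j))

/-- The cycle length `t_k`: `t₄ = 8`, `t₅ = 14`, and `t_k = k²` for `k ≥ 6`. -/
def tk (k : ℕ) : ℕ := if k = 4 then 8 else if k = 5 then 14 else k ^ 2

/-- Shift all vertices of a hypergraph by `a` (used to form vertex-disjoint unions). -/
def shiftHG (a : ℕ) (G : Finset (Finset ℕ)) : Finset (Finset ℕ) :=
  G.image (Finset.image (· + a))

/-- A set of edges is `m`-intersecting if any two distinct edges meet in at most `m` vertices. -/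
def IntersectingLE (m : ℕ) (S : Finset (Finset ℕ)) : Prop :=
  ∀ e ∈ S, ∀ f ∈ S, e ≠ f → (e ∩ f).card ≤ m

/-- `e₀` is an attachment edge of `Fst` as a member of the family `F*(F₁,F₂)`. -/
def IsAttachment (F1 F2 Fst : Finset (Finset ℕ)) (e0 : Finset ℕ) : Prop :=
  ∃ F2' : Finset (Finset ℕ), e0 ∈ F2' ∧ IsCopy F2 F2' ∧
    ∃ g : Finset ℕ → Finset (Finset ℕ),
      (∀ e ∈ F2'.erase e0, IsCopy F1 (g e) ∧ e ∈ g e) ∧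
      Fst = F2' ∪ (F2'.erase e0).biUnion g

/-- `Fst` is a member of the family `F*(F₁,F₂)`. -/
def IsFStar (F1 F2 Fst : Finset (Finset ℕ)) : Prop := ∃ e0, IsAttachment F1 F2 Fst e0

/-- `Fst` is a generic member of `F*(F₁,F₂)`. -/
def IsGeneric (F1 F2 Fst : Finset (Finset ℕ)) : Prop :=
  ∃ F2' : Finset (Finset ℕ), ∃ e0 ∈ F2', IsCopy F2 F2' ∧
    ∃ g : Finset ℕ → Finset (Finset ℕ),
      (∀ e ∈ F2'.erase e0, IsCopy F1 (g e) ∧ e ∈ g e) ∧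
      Fst = F2' ∪ (F2'.erase e0).biUnion g ∧
      (∀ e ∈ F2'.erase e0, vset (g e) ∩ vset F2' = e) ∧
      (∀ e ∈ F2'.erase e0, ∀ e' ∈ F2'.erase e0, e ≠ e' →
        (vset (g e) \ e) ∩ (vset (g e') \ e') = ∅)

/-- The family `F*(F₁,F₂)` is asymmetric-balanced. -/
def AsymBalanced (k : ℕ) (F1 F2 : Finset (Finset ℕ)) : Prop :=
  ∀ Fst, IsFStar F1 F2 Fst →
    ∀ H ⊆ Fst, vset H ⊂ vset Fst → (∃ e0 ∈ H, IsAttachment F1 F2 Fst e0) →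
      mkA k F1 F2 ≤ ((Fst.card : ℝ) - (H.card : ℝ)) / ((vcount Fst : ℝ) - (vcount H : ℝ)) ∧
      (((Fst.card : ℝ) - (H.card : ℝ)) / ((vcount Fst : ℝ) - (vcount H : ℝ)) = mkA k F1 F2 →
        (∃ e0, IsAttachment F1 F2 Fst e0 ∧ H = {e0}) ∧ IsGeneric F1 F2 Fst)

/-- An edge `e` of `G` is closed (w.r.t. `F₁`, `F₂`): it lies in a copy of `F₁` and a copy
of `F₂` inside `G` whose edge sets intersect exactly in `{e}`. -/
def ClosedEdge (F1 F2 G : Finset (Finset ℕ)) (e : Finset ℕ) : Prop :=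
  ∃ A ⊆ G, ∃ B ⊆ G, IsCopy F1 A ∧ IsCopy F2 B ∧ A ∩ B = {e}

/-- Every edge of `G` is closed within `G`. -/
def SelfClosed (F1 F2 G : Finset (Finset ℕ)) : Prop := ∀ e ∈ G, ClosedEdge F1 F2 G e

/-- `Ĥ`: the subgraph of `H` obtained by repeatedly deleting open edges; equivalently the
largest subgraph of `H` all of whose edges are closed within it. -/
noncomputable def hatH (F1 F2 H : Finset (Finset ℕ)) : Finset (Finset ℕ) :=
  (H.powerset.filter (fun G => SelfClosed F1 F2 G)).sup id

/-- `G'` is an `(F₁,F₂)`-core of `Ĥ`. -/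
def IsCore (F1 F2 H G' : Finset (Finset ℕ)) : Prop :=
  G' ⊆ hatH F1 F2 H ∧
    ∀ A ⊆ hatH F1 F2 H, (IsCopy F1 A ∨ IsCopy F2 A) → (A ⊆ G' ∨ A ∩ G' = ∅)

/-- `G'` is a minimal (nonempty) closed `(F₁,F₂)`-core of `Ĥ`. -/
def IsMinimalCore (F1 F2 H G' : Finset (Finset ℕ)) : Prop :=
  G'.Nonempty ∧ IsCore F1 F2 H G' ∧
    ∀ G'' ⊆ G', G''.Nonempty → G'' ≠ G' → ¬ IsCore F1 F2 H G''


lemma mem_vset {G : Finset (Finset ℕ)} {x : ℕ} : x ∈ vset G ↔ ∃ e ∈ G, x ∈ e := by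
  simp [vset, Finset.mem_sup]

lemma subset_vset {G : Finset (Finset ℕ)} {e : Finset ℕ} (he : e ∈ G) : e ⊆ vset G :=
  fun _ hx => mem_vset.2 ⟨e, he, hx⟩

lemma vset_mono {G H : Finset (Finset ℕ)} (h : G ⊆ H) : vset G ⊆ vset H := by
  intro x hx
  obtain ⟨e, he, hx⟩ := mem_vset.1 hx
  exact mem_vset.2 ⟨e, h he, hx⟩

lemma vset_union (G H : Finset (Finset ℕ)) : vset (G ∪ H) = vset G ∪ vset H := by
  simp [vset, Finset.sup_union]

lemma copy_sub {F A I : Finset (Finset ℕ)} (h : IsCopy F A) (hI : I ⊆ A) :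
    ∃ H ⊆ F, H.card = I.card ∧ vcount H = vcount I := by
  obtain ⟨f, hf, rfl⟩ := h
  refine ⟨F.filter (fun e => e.image f ∈ I), Finset.filter_subset _ _, ?_, ?_⟩
  · have hIi : I = (F.filter (fun e => e.image f ∈ I)).image (Finset.image f) := by
      ext e
      simp only [Finset.mem_image, Finset.mem_filter]
      constructor
      · intro he
        obtain ⟨a, ha, rfl⟩ := Finset.mem_image.1 (hI he)
        exact ⟨a, ⟨ha, he⟩, rfl⟩
      · rintro ⟨a, ⟨_, h⟩, rfl⟩
        exact h
    conv_rhs => rw [hIi]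
    rw [Finset.card_image_of_injOn]
    intro a ha b hb hab
    have ha' := subset_vset (Finset.mem_filter.1 ha).1
    have hb' := subset_vset (Finset.mem_filter.1 hb).1
    have hab' : a.image f = b.image f := hab
    ext x
    constructor
    · intro hx
      have : f x ∈ b.image f := hab' ▸ Finset.mem_image_of_mem f hx
      obtain ⟨y, hy, hxy⟩ := Finset.mem_image.1 this
      rwa [← hf (hb' hy) (ha' hx) hxy]
    · intro hx
      have : f x ∈ a.image f := hab' ▸ Finset.mem_image_of_mem f hx
      obtain ⟨y, hy, hxy⟩ := Finset.mem_image.1 this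
      rwa [← hf (ha' hy) (hb' hx) hxy]
  · have hv : vset I = (vset (F.filter (fun e => e.image f ∈ I))).image f := by
      ext x
      simp only [Finset.mem_image, mem_vset, Finset.mem_filter]
      constructor
      · rintro ⟨e, he, hx⟩
        obtain ⟨a, ha, rfl⟩ := Finset.mem_image.1 (hI he)
        obtain ⟨y, hy, rfl⟩ := Finset.mem_image.1 hx
        exact ⟨y, ⟨a, ⟨ha, he⟩, hy⟩, rfl⟩
      · rintro ⟨y, ⟨a, ⟨_, he⟩, hy⟩, rfl⟩
        exact ⟨_, he, Finset.mem_image_of_mem f hy⟩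
    unfold vcount
    rw [hv, Finset.card_image_of_injOn]
    exact hf.mono (by exact_mod_cast vset_mono (Finset.filter_subset _ _))

lemma copy_card {F A : Finset (Finset ℕ)} (h : IsCopy F A) :
    A.card = F.card ∧ vcount A = vcount F := by
  have key : ∀ H ⊆ F, H.card = A.card → H = F := by
    intro H hH hc
    apply Finset.eq_of_subset_of_card_le hH
    obtain ⟨f, _, rfl⟩ := h
    rw [hc]
    obtain ⟨H', hH', h1, _⟩ := copy_sub (F := F) ⟨f, ‹_›, rfl⟩ (Finset.Subset.refl _)
    rw [Finset.card_image_of_injOn]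
    intro a ha b hb hab
    have ha' := subset_vset ha
    have hb' := subset_vset hb
    have hab' : a.image f = b.image f := hab
    have hf : Set.InjOn f ↑(vset F) := ‹_›
    ext x
    constructor
    · intro hx
      have : f x ∈ b.image f := hab' ▸ Finset.mem_image_of_mem f hx
      obtain ⟨y, hy, hxy⟩ := Finset.mem_image.1 this
      rwa [← hf (hb' hy) (ha' hx) hxy]
    · intro hx
      have : f x ∈ a.image f := hab' ▸ Finset.mem_image_of_mem f hx
      obtain ⟨y, hy, hxy⟩ := Finset.mem_image.1 this
      rwa [← hf (ha' hy) (hb' hx) hxy]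
  obtain ⟨H, hH, h1, h2⟩ := copy_sub h (Finset.Subset.refl A)
  have := key H hH h1
  subst this
  exact ⟨h1.symm, h2.symm⟩

lemma sum_superset (E F : Finset (Finset ℕ)) (hF : F ⊆ E) (p : ℝ) :
    ∑ G ∈ E.powerset, (p ^ G.card * (1 - p) ^ (E.card - G.card)) * (if F ⊆ G then 1 else 0)
      = p ^ F.card := by
  simp only [mul_ite, mul_one, mul_zero]
  rw [← Finset.sum_filter]
  have h := Finset.sum_pow_mul_eq_add_pow p (1 - p) (E \ F)
  rw [add_sub_cancel, one_pow] at h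
  have h' : p ^ F.card = ∑ t ∈ (E \ F).powerset,
      p ^ F.card * (p ^ t.card * (1 - p) ^ ((E \ F).card - t.card)) := by
    rw [← Finset.mul_sum, h, mul_one]
  rw [h']
  refine Finset.sum_nbij' (fun G => G \ F) (fun T => T ∪ F) ?_ ?_ ?_ ?_ ?_
  · intro G hG
    simp only [Finset.mem_filter, Finset.mem_powerset] at hG ⊢
    exact Finset.sdiff_subset_sdiff hG.1 (Finset.Subset.refl _)
  · intro T hT
    simp only [Finset.mem_filter, Finset.mem_powerset] at hT ⊢
    exact ⟨Finset.union_subset (hT.trans Finset.sdiff_subset) hF, Finset.subset_union_right⟩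
  · intro G hG
    simp only [Finset.mem_filter, Finset.mem_powerset] at hG
    exact Finset.sdiff_union_of_subset hG.2
  · intro T hT
    simp only [Finset.mem_powerset] at hT
    ext x
    simp only [Finset.mem_sdiff, Finset.mem_union]
    constructor
    · tauto
    · intro hx
      exact ⟨Or.inl hx, (Finset.mem_sdiff.1 (hT hx)).2⟩
  · intro G hG
    simp only [Finset.mem_filter, Finset.mem_powerset] at hG
    have h1 := Finset.card_sdiff_add_card_eq_card hG.2
    have h2 := Finset.card_sdiff_add_card_eq_card hF
    have h3 := Finset.card_le_card hG.1
    have e1 : F.card + (G \ F).card = G.card := by omega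
    have e2 : (E \ F).card - (G \ F).card = E.card - G.card := by omega
    rw [← mul_assoc, ← pow_add, e1, e2]

lemma expectCount_eq (k n : ℕ) (p : ℝ) (ℱ : Finset (Finset (Finset ℕ)))
    (h : ∀ F ∈ ℱ, F ⊆ allEdges k n) : expectCount k n p ℱ = ∑ F ∈ ℱ, p ^ F.card := by
  unfold expectCount
  rw [← Finset.sum_congr rfl (fun F hF => sum_superset (allEdges k n) F (h F hF) p),
    Finset.sum_comm]
  refine Finset.sum_congr rfl fun G _ => ?_
  rw [← Finset.mul_sum, Finset.card_filter]
  push_cast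
  rfl

lemma exists_delta {α : Type*} (s : Finset α) (f : α → ℝ) (h : ∀ x ∈ s, 0 < f x) :
    ∃ δ > 0, ∀ x ∈ s, δ ≤ f x := by
  induction s using Finset.induction_on with
  | empty => exact ⟨1, one_pos, by simp⟩
  | insert a s _ ih =>
    obtain ⟨δ, hδ, h'⟩ := ih fun x hx => h x (Finset.mem_insert_of_mem hx)
    refine ⟨min δ (f a), lt_min hδ (h a (Finset.mem_insert_self _ _)), ?_⟩
    intro x hx
    rcases Finset.mem_insert.1 hx with rfl | hx
    · exact min_le_right _ _
    · exact (min_le_left _ _).trans (h' x hx)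

lemma count_le (k n v : ℕ) (ℱ : Finset (Finset (Finset ℕ)))
    (h : ∀ F ∈ ℱ, F ⊆ allEdges k n) :
    (ℱ.filter (fun F => vcount F = v)).card ≤ n ^ v * 2 ^ (2 ^ v) := by
  have hsub : ℱ.filter (fun F => vcount F = v) ⊆
      ((Finset.range n).powersetCard v).biUnion (fun S => S.powerset.powerset) := by
    intro F hF
    obtain ⟨hF, hv⟩ := Finset.mem_filter.1 hF
    refine Finset.mem_biUnion.2 ⟨vset F, ?_, ?_⟩
    · refine Finset.mem_powersetCard.2 ⟨?_, hv⟩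
      intro x hx
      obtain ⟨e, he, hx⟩ := mem_vset.1 hx
      exact (Finset.mem_powersetCard.1 (h F hF he)).1 hx
    · exact Finset.mem_powerset.2 fun e he => Finset.mem_powerset.2 (subset_vset he)
  refine (Finset.card_le_card hsub).trans ?_
  refine (Finset.card_biUnion_le_card_mul _ _ (2 ^ (2 ^ v)) ?_).trans ?_
  · intro S hS
    rw [Finset.card_powerset, Finset.card_powerset, (Finset.mem_powersetCard.1 hS).2]
  · rw [Finset.card_powersetCard, Finset.card_range]
    exact Nat.mul_le_mul_right _ (Nat.choose_le_pow n v)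

lemma sum_le (k n V : ℕ) (hn : 0 < n) (ℱ : Finset (Finset (Finset ℕ)))
    (h : ∀ F ∈ ℱ, F ⊆ allEdges k n) (hV : ∀ F ∈ ℱ, vcount F ≤ V) :
    ∑ F ∈ ℱ, (n : ℝ) ^ (-(vcount F : ℝ)) ≤ ∑ v ∈ Finset.range (V + 1), (2 : ℝ) ^ (2 ^ v) := by
  have hn' : (0 : ℝ) < n := by exact_mod_cast hn
  rw [← Finset.sum_fiberwise_of_maps_to (s := ℱ) (t := Finset.range (V + 1)) (g := vcount)
    (fun F hF => Finset.mem_range.2 (Nat.lt_succ_of_le (hV F hF)))]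
  refine Finset.sum_le_sum fun v _ => ?_
  have : ∀ F ∈ ℱ.filter (fun F => vcount F = v), (n : ℝ) ^ (-(vcount F : ℝ)) = ((n : ℝ) ^ v)⁻¹ := by
    intro F hF
    rw [(Finset.mem_filter.1 hF).2, Real.rpow_neg hn'.le, Real.rpow_natCast]
  rw [Finset.sum_congr rfl this, Finset.sum_const, nsmul_eq_mul]
  have hc : ((ℱ.filter (fun F => vcount F = v)).card : ℝ) ≤ (n : ℝ) ^ v * 2 ^ (2 ^ v) := by
    exact_mod_cast count_le k n v ℱ h
  rw [← div_eq_mul_inv, div_le_iff₀ (by positivity), mul_comm]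
  exact hc

lemma vcount_ge {k : ℕ} {H : Finset (Finset ℕ)} (hu : IsUniform k H) (hne : H.Nonempty) :
    k ≤ vcount H := by
  obtain ⟨e, he⟩ := hne
  rw [← hu e he]
  exact Finset.card_le_card (subset_vset he)

lemma mkA_attained (k : ℕ) (F1 F2 : Finset (Finset ℕ)) (hne : F1.Nonempty)
    (hsb : StrictlyBalancedWrt k F1 F2) :
    mkA k F1 F2 = (F1.card : ℝ) / ((vcount F1 : ℝ) - (k : ℝ) + 1 / mk k F2) := by
  have hfin : {x : ℝ | ∃ H ⊆ F1, H.Nonempty ∧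
    x = (H.card : ℝ) / ((vcount H : ℝ) - (k : ℝ) + 1 / mk k F2)}.Finite := by
    refine (F1.powerset.image (fun H => (H.card : ℝ) /
      ((vcount H : ℝ) - (k : ℝ) + 1 / mk k F2))).finite_toSet.subset ?_
    rintro x ⟨H, hH, _, rfl⟩
    exact Finset.mem_coe.2 (Finset.mem_image.2 ⟨H, Finset.mem_powerset.2 hH, rfl⟩)
  have hmem := Set.Nonempty.csSup_mem (by exact ⟨_, F1, Finset.Subset.refl _, hne, rfl⟩) hfin
  obtain ⟨H, hH, hHne, hx⟩ := hmem
  by_cases hHF : H = F1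
  · subst hHF; exact hx
  · exact absurd hx (hsb H hH hHne hHF).ne'

/-- a bound on the expected number of members of a family of unions of two
overlapping `F₁`-copies appearing in `H^k(n,p)` at `p = C·n^{-1/m_k(F₁,F₂)}`. -/
theorem expected_funionf (k : ℕ) (hk : 1 ≤ k) (F1 F2 : Finset (Finset ℕ))
    (hu1 : IsUniform k F1) (hu2 : IsUniform k F2)
    (hpos : 0 < mk k F2) (h12 : mk k F2 ≤ mk k F1)
    (hsb : StrictlyBalancedWrt k F1 F2)
    (C : ℝ) (hC : 0 < C) :
    ∃ δ C' : ℝ, 0 < δ ∧ 0 < C' ∧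
      ∀ n : ℕ, ∀ ℱ : Finset (Finset (Finset ℕ)),
        (∀ F ∈ ℱ, F ⊆ allEdges k n ∧ ∃ A B : Finset (Finset ℕ),
          IsCopy F1 A ∧ IsCopy F1 B ∧ A ≠ B ∧ (A ∩ B).Nonempty ∧ F = A ∪ B) →
        C * (n : ℝ) ^ (-(1 / mkA k F1 F2)) ≤ 1 →
        expectCount k n (C * (n : ℝ) ^ (-(1 / mkA k F1 F2))) ℱ ≤
          C' * (n : ℝ) ^ ((k : ℝ) - 1 / mk k F2 - δ / 2) := by
  have triv : ∀ (n : ℕ) (p x C' : ℝ), 0 < C' → expectCount k n p ∅ ≤ C' * (n : ℝ) ^ x := by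
    intro n p x C' hC'
    rw [expectCount_eq k n p ∅ (by simp)]
    simp only [Finset.sum_empty]
    positivity
  rcases F1.eq_empty_or_nonempty with hF1 | hF1
  · refine ⟨1, 1, one_pos, one_pos, ?_⟩
    intro n ℱ hℱ _
    have : ℱ = ∅ := by
      rw [Finset.eq_empty_iff_forall_notMem]
      intro F hF
      obtain ⟨_, A, B, ⟨f, _, hA⟩, _, _, hne, _⟩ := hℱ F hF
      subst hF1
      simp [hA] at hne
    subst this
    exact triv _ _ _ _ one_pos
  have hm := mkA_attained k F1 F2 hF1 hsb
  unfold StrictlyBalancedWrt at hsb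
  have ha : 0 < 1 / mk k F2 := by positivity
  set a := 1 / mk k F2 with hadef
  set m := mkA k F1 F2 with hmdef
  have hden : ∀ H ⊆ F1, H.Nonempty → 0 < (vcount H : ℝ) - k + a := by
    intro H hH hne
    have : (k : ℝ) ≤ vcount H := by
      exact_mod_cast vcount_ge (fun e he => hu1 e (hH he)) hne
    linarith
  have hd1 := hden F1 (Finset.Subset.refl _) hF1
  have he1 : (0 : ℝ) < F1.card := by exact_mod_cast hF1.card_pos
  have hm0 : 0 < m := by rw [hm]; positivity
  have hF1eq : (vcount F1 : ℝ) - F1.card * (1 / m) = k - a := by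
    have : (F1.card : ℝ) * (1 / m) = (vcount F1 : ℝ) - k + a := by
      rw [hm]; field_simp
    linarith
  obtain ⟨δ, hδ, hδ'⟩ := exists_delta (F1.powerset.filter (fun H => H.Nonempty ∧ H ≠ F1))
    (fun H => (vcount H : ℝ) - H.card * (1 / m) - (k - a)) (by
      intro H hH
      obtain ⟨h1, h2, h3⟩ := Finset.mem_filter.1 hH
      have h1 := Finset.mem_powerset.1 h1
      have := hsb H h1 h2 h3
      rw [div_lt_iff₀ (hden H h1 h2)] at this
      have : (H.card : ℝ) * (1 / m) < (vcount H : ℝ) - k + a := by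
        rw [mul_one_div, div_lt_iff₀ hm0]; linarith
      show 0 < (vcount H : ℝ) - H.card * (1 / m) - (k - a)
      linarith)
  set S : ℝ := ∑ v ∈ Finset.range (2 * vcount F1 + 1), (2 : ℝ) ^ (2 ^ v) with hS
  have hSpos : 0 < S := Finset.sum_pos (fun _ _ => by positivity) ⟨0, by simp⟩
  set M : ℝ := (max 1 C) ^ (2 * F1.card) with hM
  have hMpos : 0 < M := by positivity
  refine ⟨δ, M * S, hδ, by positivity, ?_⟩
  intro n ℱ hℱ _
  rcases Nat.eq_zero_or_pos n with hn | hn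
  · have : ℱ = ∅ := by
      rw [Finset.eq_empty_iff_forall_notMem]
      intro F hF
      obtain ⟨hFE, A, B, _, _, _, ⟨e, he⟩, rfl⟩ := hℱ F hF
      have := hFE (Finset.mem_union_left _ (Finset.mem_inter.1 he).1)
      have := Finset.mem_powersetCard.1 this
      subst hn
      have h0 : e = ∅ := by simpa using this.1
      have := this.2
      rw [h0] at this
      simp at this
      omega
    subst this
    exact triv _ _ _ _ (by positivity)
  have hn1 : (1 : ℝ) ≤ n := by exact_mod_cast hn
  have hn0 : (0 : ℝ) < n := by linarith
  have hE : ∀ F ∈ ℱ, F ⊆ allEdges k n := fun F hF => (hℱ F hF).1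
  rw [expectCount_eq k n _ ℱ hE]
  have hdata : ∀ F ∈ ℱ, vcount F ≤ 2 * vcount F1 ∧ F.card ≤ 2 * F1.card ∧
      (vcount F : ℝ) - F.card * (1 / m) ≤ k - a - δ := by
    intro F hF
    obtain ⟨_, A, B, hA, hB, hAB, hne, rfl⟩ := hℱ F hF
    obtain ⟨hA1, hA2⟩ := copy_card hA
    obtain ⟨hB1, hB2⟩ := copy_card hB
    obtain ⟨H, hH, hc, hv⟩ := copy_sub hA (Finset.inter_subset_left : A ∩ B ⊆ A)
    have hlt : (A ∩ B).card < F1.card := by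
      rw [← hA1]
      refine Finset.card_lt_card (Finset.ssubset_iff_subset_ne.2 ⟨Finset.inter_subset_left, ?_⟩)
      intro h
      exact hAB (Finset.eq_of_subset_of_card_le (Finset.inter_eq_left.1 h) (by omega))
    have hcard := Finset.card_union_add_card_inter A B
    have hvc : vcount (A ∪ B) + vcount (A ∩ B) ≤ vcount A + vcount B := by
      unfold vcount
      rw [vset_union, ← Finset.card_union_add_card_inter (vset A) (vset B)]
      gcongr
      exact Finset.subset_inter (vset_mono Finset.inter_subset_left)
        (vset_mono Finset.inter_subset_right)
    have hHne : H.Nonempty := by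
      rw [← Finset.card_pos, hc]; exact hne.card_pos
    have hHF : H ≠ F1 := by rintro rfl; omega
    have key := hδ' H (Finset.mem_filter.2 ⟨Finset.mem_powerset.2 hH, hHne, hHF⟩)
    rw [hc, hv] at key
    refine ⟨by omega, by omega, ?_⟩
    have h1 : ((A ∪ B).card : ℝ) = 2 * F1.card - (A ∩ B).card := by
      have : ((A ∪ B).card : ℝ) + (A ∩ B).card = A.card + B.card := by exact_mod_cast hcard
      rw [hA1, hB1] at this
      linarith
    have h2 : (vcount (A ∪ B) : ℝ) + vcount (A ∩ B) ≤ 2 * vcount F1 := by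
      rw [hA2, hB2] at hvc
      have : (vcount (A ∪ B) : ℝ) + vcount (A ∩ B) ≤ vcount F1 + vcount F1 := by
        exact_mod_cast hvc
      linarith
    rw [h1, sub_mul, mul_assoc]
    linarith
  have hterm : ∀ F ∈ ℱ, (C * (n : ℝ) ^ (-(1 / m))) ^ F.card ≤
      M * (n : ℝ) ^ ((k : ℝ) - a - δ / 2) * (n : ℝ) ^ (-(vcount F : ℝ)) := by
    intro F hF
    obtain ⟨_, h2, h3⟩ := hdata F hF
    rw [mul_pow, ← Real.rpow_natCast ((n : ℝ) ^ (-(1 / m))), ← Real.rpow_mul hn0.le, mul_assoc,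
      ← Real.rpow_add hn0]
    apply mul_le_mul
    · calc C ^ F.card ≤ (max 1 C) ^ F.card := pow_le_pow_left₀ hC.le (le_max_right _ _) _
        _ ≤ M := pow_le_pow_right₀ (le_max_left _ _) h2
    · apply Real.rpow_le_rpow_of_exponent_le hn1
      linarith
    · positivity
    · positivity
  calc ∑ F ∈ ℱ, (C * (n : ℝ) ^ (-(1 / m))) ^ F.card
      ≤ ∑ F ∈ ℱ, M * (n : ℝ) ^ ((k : ℝ) - a - δ / 2) * (n : ℝ) ^ (-(vcount F : ℝ)) :=
        Finset.sum_le_sum hterm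
    _ = M * (n : ℝ) ^ ((k : ℝ) - a - δ / 2) * ∑ F ∈ ℱ, (n : ℝ) ^ (-(vcount F : ℝ)) := by
        rw [Finset.mul_sum]
    _ ≤ M * (n : ℝ) ^ ((k : ℝ) - a - δ / 2) * S := by
        apply mul_le_mul_of_nonneg_left _ (by positivity)
        exact sum_le k n _ hn ℱ hE fun F hF => (hdata F hF).1
    _ = M * S * (n : ℝ) ^ ((k : ℝ) - a - δ / 2) := by ring

end ARR
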